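/- arXiv:2101.12400 — 11 statements merged into one kernel-verified Lean document; each statement's English description precedes it below -/
import Mathlib

section
/- For all integers m ≥ 1 and n ≥ 1, the binomial identity ∑_{r=0}^{m} C(n+r, n) · C(n+m−r, n) = C(2n+m+1, m) holds, where C(a, b) denotes the binomial coefficient a choose b. -/
theorem sum_choose_mul_choose (m n : ℕ) (hm : 1 ≤ m) (hn : 1 ≤ n) :
    ∑ r ∈ Finset.range (m + 1), (n + r).choose n * (n + m - r).choose n
      = (2 * n + m + 1).choose m := by
  have h : (PowerSeries.mk 1 : PowerSeries ℤ) ^ (n + 1) * PowerSeries.mk 1 ^ (n + 1)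
      = PowerSeries.mk 1 ^ (2 * n + 1 + 1) := by ring
  simp only [PowerSeries.mk_one_pow_eq_mk_choose_add] at h
  have hc := congrArg (PowerSeries.coeff m) h
  simp only [PowerSeries.coeff_mul, PowerSeries.coeff_mk,
    Finset.Nat.sum_antidiagonal_eq_sum_range_succ_mk] at hc
  rw [show 2 * n + m + 1 = 2 * n + 1 + m by ring, ← Nat.choose_symm_add]
  norm_cast at hc
  rw [← hc]
  refine Finset.sum_congr rfl fun r hr => ?_
  rw [Nat.add_sub_assoc (Finset.mem_range_succ_iff.mp hr)]
end

section
/- For every integer k ≥ 1, the identity ∑_{r=0}^{k−1} C(k−1, r)² / ( C(2k−2, r) · C(2k−2, k−1−r) ) = C(3k−2, k−1) / C(2k−2, k−1)² holds in the rational numbers; equivalently, this common value equals ((k−1)!)³ · (3k−2)! / ( ((2k−2)!)² · (2k−1)! ). -/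
open Finset PowerSeries in
theorem sum_antidiagonal_add_choose_mul_add_choose (a b n : ℕ) :
    ∑ ij ∈ antidiagonal n, (a + ij.1).choose a * (b + ij.2).choose b
      = (a + b + 1 + n).choose (a + b + 1) := by
  have h : (PowerSeries.mk 1 : ℤ⟦X⟧) ^ (a + 1) * PowerSeries.mk 1 ^ (b + 1)
      = PowerSeries.mk 1 ^ (a + b + 1 + 1) := by
    rw [← pow_add]
    congr 1
    ring
  simp only [mk_one_pow_eq_mk_choose_add] at h
  have hn := congrArg (coeff n) h
  simp only [coeff_mul, coeff_mk] at hn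
  exact_mod_cast hn

theorem choose_sq_div_eq {n i j : ℕ} (h : i + j = n) :
    (n.choose i : ℚ) ^ 2 / (((2 * n).choose i : ℚ) * ((2 * n).choose j : ℚ))
      = ((n + i).choose n * (n + j).choose n : ℕ) / ((2 * n).choose n : ℚ) ^ 2 := by
  have hi : 2 * n = i + (n + j) := by omega
  have hj : 2 * n = j + (n + i) := by omega
  have h₁ : (n.choose i : ℚ) = n.factorial / (i.factorial * j.factorial) := by
    rw [← h, Nat.cast_add_choose]
  have h₂ : ((2 * n).choose i : ℚ)
      = (2 * n).factorial / (i.factorial * (n + j).factorial) := by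
    rw [hi, Nat.cast_add_choose]
  have h₃ : ((2 * n).choose j : ℚ)
      = (2 * n).factorial / (j.factorial * (n + i).factorial) := by
    rw [hj, Nat.cast_add_choose]
  have h₄ : ((2 * n).choose n : ℚ) = (2 * n).factorial / (n.factorial * n.factorial) := by
    rw [two_mul, Nat.cast_add_choose]
  rw [h₁, h₂, h₃, h₄, Nat.cast_mul, Nat.cast_add_choose, Nat.cast_add_choose]
  have hf (m : ℕ) : (m.factorial : ℚ) ≠ 0 := by exact_mod_cast m.factorial_ne_zero
  have := hf n
  have := hf i
  have := hf j
  have := hf (n + i)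
  have := hf (n + j)
  have := hf (2 * n)
  field_simp

theorem sum_choose_sq_div (k : ℕ) (hk : 1 ≤ k) :
    (∑ r ∈ Finset.range k,
        ((k - 1).choose r : ℚ) ^ 2 /
          (((2 * k - 2).choose r : ℚ) * ((2 * k - 2).choose (k - 1 - r) : ℚ))
      = ((3 * k - 2).choose (k - 1) : ℚ) / ((2 * k - 2).choose (k - 1) : ℚ) ^ 2)
    ∧ ((3 * k - 2).choose (k - 1) : ℚ) / ((2 * k - 2).choose (k - 1) : ℚ) ^ 2
      = ((k - 1).factorial : ℚ) ^ 3 * ((3 * k - 2).factorial : ℚ) /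
          (((2 * k - 2).factorial : ℚ) ^ 2 * ((2 * k - 1).factorial : ℚ)) := by
  obtain ⟨n, rfl⟩ : ∃ n, k = n + 1 := ⟨k - 1, by omega⟩
  have e₂ : 2 * (n + 1) - 2 = 2 * n := by omega
  have e₁ : 2 * (n + 1) - 1 = n + n + 1 := by omega
  have e₃ : 3 * (n + 1) - 2 = n + n + 1 + n := by omega
  rw [e₁, e₂, e₃, Nat.add_sub_cancel]
  constructor
  · rw [← Nat.choose_symm_add (a := n + n + 1),
      ← sum_antidiagonal_add_choose_mul_add_choose n n n, Nat.cast_sum, Finset.sum_div,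
      Finset.Nat.sum_antidiagonal_eq_sum_range_succ_mk]
    refine Finset.sum_congr rfl fun r hr => ?_
    rw [Finset.mem_range] at hr
    exact choose_sq_div_eq (by omega)
  · rw [← Nat.choose_symm_add (a := n + n + 1), Nat.cast_add_choose, two_mul,
      Nat.cast_add_choose]
    have hf (m : ℕ) : (m.factorial : ℚ) ≠ 0 := by exact_mod_cast m.factorial_ne_zero
    have := hf n
    have := hf (n + n)
    have := hf (n + n + 1)
    field_simp
end

section
/- Let N be a squarefree positive integer whose number of prime factors is odd and which has no prime factor congruent to 1 modulo 4. Then for every prime p, the equation x² + y² + N·z² = 0 has a solution (x, y, z) ≠ (0, 0, 0) in ℚ_p if and only if p does not divide N. (This expresses that the quaternion algebra (−1, −N / ℚ) is ramified exactly at the primes dividing N and at infinity, i.e., it is the definite quaternion algebra over ℚ of discriminant N.) -/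
lemma PadicInt.exists_sq_eq_of_norm_sub_lt {p : ℕ} [Fact p.Prime] (t a : ℤ_[p])
    (h : ‖a ^ 2 - t‖ < ‖2 * a‖ ^ 2) : ∃ x : ℤ_[p], x ^ 2 = t := by
  have := hensels_lemma (p := p) (R := ℤ_[p]) (F := Polynomial.X ^ 2 - Polynomial.C t) (a := a)
    (by simpa [one_add_one_eq_two] using h)
  obtain ⟨z, hz, -⟩ := this
  exact ⟨z, by simpa [sub_eq_zero] using hz⟩

lemma Padic.exists_padicInt_zero_of_zero {p : ℕ} [Fact p.Prime] (N : ℕ)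
    (h : ∃ x y z : ℚ_[p], (x, y, z) ≠ (0, 0, 0) ∧ x ^ 2 + y ^ 2 + (N : ℚ_[p]) * z ^ 2 = 0) :
    ∃ x y z : ℤ_[p], (x = 1 ∨ y = 1 ∨ z = 1) ∧ x ^ 2 + y ^ 2 + (N : ℤ_[p]) * z ^ 2 = 0 := by
  obtain ⟨x, y, z, hne, h⟩ := h
  have scale : ∀ w : ℚ_[p], ‖x‖ ≤ ‖w‖ → ‖y‖ ≤ ‖w‖ → ‖z‖ ≤ ‖w‖ → (w = x ∨ w = y ∨ w = z) →
      ∃ x y z : ℤ_[p], (x = 1 ∨ y = 1 ∨ z = 1) ∧ x ^ 2 + y ^ 2 + (N : ℤ_[p]) * z ^ 2 = 0 := by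
    intro w hx hy hz hw
    have hw0 : w ≠ 0 := by
      rintro rfl
      simp only [norm_zero, norm_le_zero_iff] at hx hy hz
      exact hne (by rw [hx, hy, hz])
    have hle : ∀ v : ℚ_[p], ‖v‖ ≤ ‖w‖ → ‖v / w‖ ≤ 1 := fun v hv => by
      rw [norm_div]
      exact div_le_one_of_le₀ hv (norm_nonneg _)
    refine ⟨⟨x / w, hle x hx⟩, ⟨y / w, hle y hy⟩, ⟨z / w, hle z hz⟩, ?_, ?_⟩
    · rcases hw with rfl | rfl | rfl
      · exact Or.inl (Subtype.ext (div_self hw0))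
      · exact Or.inr (Or.inl (Subtype.ext (div_self hw0)))
      · exact Or.inr (Or.inr (Subtype.ext (div_self hw0)))
    · apply Subtype.ext
      change (x / w) ^ 2 + (y / w) ^ 2 + (N : ℚ_[p]) * (z / w) ^ 2 = 0
      field_simp
      rw [h, mul_zero]
  rcases le_total ‖x‖ ‖y‖ with h1 | h1 <;> rcases le_total ‖y‖ ‖z‖ with h2 | h2 <;>
    rcases le_total ‖x‖ ‖z‖ with h3 | h3
  · exact scale z h3 h2 le_rfl (by simp)
  · exact scale z (h1.trans h2) h2 le_rfl (by simp)
  · exact scale y h1 le_rfl h2 (by simp)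
  · exact scale y h1 le_rfl h2 (by simp)
  · exact scale z h3 h2 le_rfl (by simp)
  · exact scale x le_rfl h1 h3 (by simp)
  · exact scale x le_rfl h1 (h2.trans h1) (by simp)
  · exact scale x le_rfl h1 h3 (by simp)

lemma Finset.cast_prod_zmod_four {s : Finset ℕ} (hs : ∀ q ∈ s, q % 4 = 3) :
    ((∏ q ∈ s, q : ℕ) : ZMod 4) = (-1) ^ s.card := by
  rw [Nat.cast_prod]
  refine Finset.prod_eq_pow_card fun q hq => ?_
  rw [← ZMod.natCast_mod, hs q hq]
  decide

lemma Nat.Prime.mod_four_eq_three {q : ℕ} (hq : q.Prime) (h2 : q ≠ 2) (h1 : q % 4 ≠ 1) :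
    q % 4 = 3 := by
  have := hq.mod_two_eq_one_iff_ne_two.mpr h2
  omega

lemma Nat.mod_four_eq_three_of_odd_card_primeFactors {N : ℕ} (hsq : Squarefree N)
    (hodd : Odd N.primeFactors.card) (h4 : ∀ q : ℕ, q.Prime → q ∣ N → q % 4 ≠ 1)
    (h2 : ¬ 2 ∣ N) : N % 4 = 3 := by
  have h := Finset.cast_prod_zmod_four (s := N.primeFactors) fun q hq => by
    have hq' := Nat.prime_of_mem_primeFactors hq
    have hd := Nat.dvd_of_mem_primeFactors hq
    exact hq'.mod_four_eq_three (fun h => h2 (h ▸ hd)) (h4 q hq' hd)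
  rw [Nat.prod_primeFactors_of_squarefree hsq, hodd.neg_one_pow] at h
  exact (ZMod.natCast_eq_natCast_iff' N 3 4).mp (h.trans (by decide))

lemma Nat.mod_eight_eq_two_of_odd_card_primeFactors {N : ℕ} (hsq : Squarefree N)
    (hodd : Odd N.primeFactors.card) (h4 : ∀ q : ℕ, q.Prime → q ∣ N → q % 4 ≠ 1)
    (h2 : 2 ∣ N) : N % 8 = 2 := by
  have hmem : 2 ∈ N.primeFactors := Nat.prime_two.mem_primeFactors h2 hsq.ne_zero
  have h := Finset.cast_prod_zmod_four (s := N.primeFactors.erase 2) fun q hq => by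
    rw [Finset.mem_erase] at hq
    have hq' := Nat.prime_of_mem_primeFactors hq.2
    exact hq'.mod_four_eq_three hq.1 (h4 q hq' (Nat.dvd_of_mem_primeFactors hq.2))
  have hN := Finset.mul_prod_erase N.primeFactors (fun q => q) hmem
  rw [Nat.prod_primeFactors_of_squarefree hsq] at hN
  have heven : Even (N.primeFactors.erase 2).card := by
    rw [Finset.card_erase_of_mem hmem]
    exact Nat.Odd.sub_odd hodd odd_one
  rw [heven.neg_one_pow] at h
  have := (ZMod.natCast_eq_natCast_iff' _ 1 4).mp (h.trans (by decide))
  omega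

lemma PadicInt.sq_add_sq_add_mul_sq_ne_zero_of_two {N : ℕ} (hN : N % 8 = 2) (x y z : ℤ_[2])
    (h1 : x = 1 ∨ y = 1 ∨ z = 1) : x ^ 2 + y ^ 2 + (N : ℤ_[2]) * z ^ 2 ≠ 0 := by
  intro h
  have key : ∀ a b c : ZMod (2 ^ 3), (a = 1 ∨ b = 1 ∨ c = 1) → a ^ 2 + b ^ 2 + 2 * c ^ 2 ≠ 0 := by
    decide
  have hN' : (N : ZMod (2 ^ 3)) = 2 :=
    (ZMod.natCast_eq_natCast_iff' N 2 (2 ^ 3)).mpr (by omega)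
  refine key (toZModPow 3 x) (toZModPow 3 y) (toZModPow 3 z) ?_ ?_
  · rcases h1 with rfl | rfl | rfl <;> simp
  · simpa [hN'] using congrArg (toZModPow (p := 2) 3) h

lemma ZMod.eq_zero_of_sq_add_sq_eq_zero {p : ℕ} [Fact p.Prime] (hp : p % 4 = 3) {a b : ZMod p}
    (h : a ^ 2 + b ^ 2 = 0) : a = 0 := by
  by_contra ha
  refine ZMod.exists_sq_eq_neg_one_iff.mp ⟨b / a, ?_⟩ hp
  field_simp
  linear_combination -h

lemma PadicInt.toZMod_eq_zero_iff_dvd {p : ℕ} [Fact p.Prime] {x : ℤ_[p]} :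
    toZMod x = 0 ↔ (p : ℤ_[p]) ∣ x := by
  rw [← RingHom.mem_ker, ker_toZMod, maximalIdeal_eq_span_p, Ideal.mem_span_singleton]

lemma PadicInt.sq_add_sq_add_mul_sq_ne_zero_of_mod_four {p : ℕ} [Fact p.Prime] (hp : p % 4 = 3)
    {N : ℕ} (hsq : Squarefree N) (hpN : p ∣ N) (x y z : ℤ_[p])
    (h1 : x = 1 ∨ y = 1 ∨ z = 1) : x ^ 2 + y ^ 2 + (N : ℤ_[p]) * z ^ 2 ≠ 0 := by
  intro h
  have hmod : toZMod x ^ 2 + toZMod y ^ 2 = 0 := by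
    simpa [(ZMod.natCast_eq_zero_iff N p).mpr hpN] using congrArg (toZMod (p := p)) h
  have hx := ZMod.eq_zero_of_sq_add_sq_eq_zero hp hmod
  have hy := ZMod.eq_zero_of_sq_add_sq_eq_zero hp ((add_comm _ _).trans hmod)
  have hz : z = 1 := by
    rcases h1 with rfl | rfl | rfl
    · simp at hx
    · simp at hy
    · rfl
  obtain ⟨u, rfl⟩ := toZMod_eq_zero_iff_dvd.mp hx
  obtain ⟨v, rfl⟩ := toZMod_eq_zero_iff_dvd.mp hy
  subst hz
  have hd : (p : ℤ_[p]) ^ 2 ∣ ((N : ℤ) : ℤ_[p]) :=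
    ⟨-(u ^ 2 + v ^ 2), by push_cast; linear_combination h⟩
  rw [pow_p_dvd_int_iff] at hd
  have hd' : p * p ∣ N := by
    rw [← sq]
    exact_mod_cast hd
  exact (Fact.out : p.Prime).not_isUnit (hsq p hd')

lemma PadicInt.exists_sq_add_sq_eq_neg_of_ne_two {p : ℕ} [Fact p.Prime] (hp : p ≠ 2) {N : ℕ}
    (hpN : ¬ p ∣ N) : ∃ x y : ℤ_[p], x ^ 2 + y ^ 2 = -(N : ℤ_[p]) := by
  obtain ⟨a, b, hab⟩ := ZMod.sq_add_sq p (-(N : ZMod p))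
  wlog ha : a ≠ 0 generalizing a b
  · refine this b a (by rw [add_comm, hab]) ?_
    rintro rfl
    rw [not_not.mp ha] at hab
    exact hpN ((ZMod.natCast_eq_zero_iff N p).mp (by linear_combination hab))
  obtain ⟨A, rfl⟩ := ZMod.ringHom_surjective (toZMod (p := p)) a
  obtain ⟨B, rfl⟩ := ZMod.ringHom_surjective (toZMod (p := p)) b
  have norm_eq : ∀ t : ℤ_[p], toZMod t ≠ 0 → ‖t‖ = 1 := fun t ht =>
    le_antisymm t.norm_le_one <| not_lt.mp fun hlt =>
      ht (toZMod_eq_zero_iff_dvd.mpr (norm_lt_one_iff_dvd t |>.mp hlt))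
  have h2 : (2 : ZMod p) ≠ 0 := by
    have : ¬ p ∣ 2 := fun h =>
      hp ((Nat.prime_dvd_prime_iff_eq Fact.out Nat.prime_two).mp h)
    rw [← ZMod.natCast_eq_zero_iff] at this
    exact_mod_cast this
  obtain ⟨x, hx⟩ := exists_sq_eq_of_norm_sub_lt (-(N : ℤ_[p]) - B ^ 2) A (by
    rw [norm_eq (2 * A) (by rw [map_mul, map_ofNat]; exact mul_ne_zero h2 ha), one_pow, norm_lt_one_iff_dvd,
      ← toZMod_eq_zero_iff_dvd]
    simp only [map_sub, map_pow, map_neg, map_natCast]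
    linear_combination hab)
  exact ⟨x, B, by rw [hx]; ring⟩

lemma PadicInt.exists_sq_eq_of_mod_eight {n : ℤ} (hn : n % 8 = 1) : ∃ x : ℤ_[2], x ^ 2 = n := by
  refine exists_sq_eq_of_norm_sub_lt (n : ℤ_[2]) 1 ?_
  have h : ‖((1 - n : ℤ) : ℤ_[2])‖ ≤ (2 : ℕ) ^ (-(3 : ℕ) : ℤ) :=
    norm_int_le_pow_iff_dvd.mpr (by norm_num; omega)
  have h2 : ‖(2 : ℤ_[2])‖ = 2⁻¹ := by simpa using norm_p (p := 2)
  push_cast at h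
  rw [one_pow, mul_one, h2]
  refine h.trans_lt ?_
  norm_num

lemma PadicInt.exists_sq_add_sq_eq_neg_of_mod_four {N : ℕ} (hN : N % 4 = 3) :
    ∃ x y : ℤ_[2], x ^ 2 + y ^ 2 = -(N : ℤ_[2]) := by
  have : N % 8 = 7 ∨ N % 8 = 3 := by omega
  rcases this with h | h
  · obtain ⟨x, hx⟩ := exists_sq_eq_of_mod_eight (n := -N) (by omega)
    exact ⟨x, 0, by rw [hx]; push_cast; ring⟩
  · obtain ⟨x, hx⟩ := exists_sq_eq_of_mod_eight (n := -N - 4) (by omega)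
    exact ⟨x, 2, by rw [hx]; push_cast; ring⟩

theorem quaternion_neg_one_neg_N_ramified_iff (N : ℕ) (hNpos : 0 < N)
    (hsq : Squarefree N) (hodd : Odd N.primeFactors.card)
    (h4 : ∀ q : ℕ, q.Prime → q ∣ N → q % 4 ≠ 1)
    (p : ℕ) [Fact p.Prime] :
    (∃ x y z : ℚ_[p], (x, y, z) ≠ (0, 0, 0) ∧
        x ^ 2 + y ^ 2 + (N : ℚ_[p]) * z ^ 2 = 0) ↔ ¬ (p ∣ N) := by
  constructor
  · intro h hpN
    obtain ⟨x, y, z, h1, h0⟩ := Padic.exists_padicInt_zero_of_zero N h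
    by_cases hp : p = 2
    · subst hp
      exact PadicInt.sq_add_sq_add_mul_sq_ne_zero_of_two
        (Nat.mod_eight_eq_two_of_odd_card_primeFactors hsq hodd h4 hpN) x y z h1 h0
    · have hprime : p.Prime := Fact.out
      exact PadicInt.sq_add_sq_add_mul_sq_ne_zero_of_mod_four
        (hprime.mod_four_eq_three hp (h4 p hprime hpN)) hsq hpN x y z h1 h0
  · intro hpN
    have : ∃ x y : ℤ_[p], x ^ 2 + y ^ 2 = -(N : ℤ_[p]) := by
      by_cases hp : p = 2
      · subst hp
        exact PadicInt.exists_sq_add_sq_eq_neg_of_mod_four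
          (Nat.mod_four_eq_three_of_odd_card_primeFactors hsq hodd h4 hpN)
      · exact PadicInt.exists_sq_add_sq_eq_neg_of_ne_two hp hpN
    obtain ⟨x, y, hxy⟩ := this
    have hxy' : (x : ℚ_[p]) ^ 2 + (y : ℚ_[p]) ^ 2 = -(N : ℚ_[p]) := by
      simpa using congrArg (fun t : ℤ_[p] => (t : ℚ_[p])) hxy
    exact ⟨x, y, 1, by simp, by rw [hxy']; ring⟩
end

section
/- Let N be a squarefree positive integer whose number of prime factors is odd and which has no prime factor congruent to 1 modulo 3. Then for every prime p, the equation x² + 3·y² + N·z² = 0 has a solution (x, y, z) ≠ (0, 0, 0) in ℚ_p if and only if p does not divide N. (This expresses that the quaternion algebra (−3, −N / ℚ) is ramified exactly at the primes dividing N and at infinity, i.e., it is the definite quaternion algebra over ℚ of discriminant N.) -/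
open Polynomial in
theorem PadicInt.exists_sq_eq_of_norm_lt {p : ℕ} [Fact p.Prime] {a u : ℤ_[p]}
    (h : ‖a ^ 2 - u‖ < ‖2 * a‖ ^ 2) : ∃ b : ℤ_[p], b ^ 2 = u := by
  have := hensels_lemma (p := p) (F := (X ^ 2 - C u : ℤ_[p][X])) (a := a)
    (by simpa [derivative_X_pow, one_add_one_eq_two] using h)
  obtain ⟨z, hz, -⟩ := this
  exact ⟨z, by simpa [sub_eq_zero] using hz⟩

theorem exists_isotropic_of_norm_lt_left {p : ℕ} [Fact p.Prime] {N : ℕ} {x y : ℤ}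
    (h : ‖((x ^ 2 + 3 * y ^ 2 + N : ℤ) : ℤ_[p])‖ < ‖(2 * x : ℤ_[p])‖ ^ 2) :
    ∃ x y z : ℚ_[p], (x, y, z) ≠ (0, 0, 0) ∧ x ^ 2 + 3 * y ^ 2 + (N : ℚ_[p]) * z ^ 2 = 0 := by
  obtain ⟨b, hb⟩ := PadicInt.exists_sq_eq_of_norm_lt (a := (x : ℤ_[p]))
    (u := -(3 * (y : ℤ_[p]) ^ 2 + N)) (by
      convert h using 2
      push_cast
      ring)
  refine ⟨b, y, 1, by simp, ?_⟩
  have := congrArg (fun t : ℤ_[p] => (t : ℚ_[p])) hb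
  have h3 : ((3 : ℤ_[p]) : ℚ_[p]) = 3 := rfl
  push_cast [h3] at this
  linear_combination this

theorem exists_isotropic_of_norm_lt_right {p : ℕ} [Fact p.Prime] {N : ℕ} {x y : ℤ}
    (h3 : ‖(3 : ℤ_[p])‖ = 1)
    (h : ‖((x ^ 2 + 3 * y ^ 2 + N : ℤ) : ℤ_[p])‖ < ‖(2 * y : ℤ_[p])‖ ^ 2) :
    ∃ x y z : ℚ_[p], (x, y, z) ≠ (0, 0, 0) ∧ x ^ 2 + 3 * y ^ 2 + (N : ℚ_[p]) * z ^ 2 = 0 := by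
  obtain ⟨b, hb⟩ := PadicInt.exists_sq_eq_of_norm_lt (a := (3 * y : ℤ_[p]))
    (u := -(3 * ((x : ℤ_[p]) ^ 2 + N))) (by
      have e1 : (3 * y : ℤ_[p]) ^ 2 - -(3 * ((x : ℤ_[p]) ^ 2 + N)) =
          3 * ((x ^ 2 + 3 * y ^ 2 + N : ℤ) : ℤ_[p]) := by
        push_cast
        ring
      have e2 : (2 * (3 * y) : ℤ_[p]) = 3 * (2 * y) := by ring
      rw [e1, e2, norm_mul, norm_mul (3 : ℤ_[p]), h3, one_mul, one_mul]
      exact h)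
  refine ⟨x, b / 3, 1, by simp, ?_⟩
  have := congrArg (fun t : ℤ_[p] => (t : ℚ_[p])) hb
  have h3 : ((3 : ℤ_[p]) : ℚ_[p]) = 3 := rfl
  push_cast [h3] at this
  field_simp
  linear_combination this

/-- A nontrivial zero of a diagonal ternary form can be scaled to a primitive integral one. -/
theorem exists_primitive_of_isotropic {p : ℕ} [Fact p.Prime] {a b : ℤ_[p]} {x y z : ℚ_[p]}
    (h0 : (x, y, z) ≠ (0, 0, 0)) (h : x ^ 2 + a * y ^ 2 + b * z ^ 2 = 0) :
    ∃ u v w : ℤ_[p], (u = 1 ∨ v = 1 ∨ w = 1) ∧ u ^ 2 + a * v ^ 2 + b * w ^ 2 = 0 := by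
  have key (t : ℚ_[p]) (hx : ‖x‖ ≤ ‖t‖) (hy : ‖y‖ ≤ ‖t‖) (hz : ‖z‖ ≤ ‖t‖)
      (ht : t = x ∨ t = y ∨ t = z) :
      ∃ u v w : ℤ_[p], (u = 1 ∨ v = 1 ∨ w = 1) ∧ u ^ 2 + a * v ^ 2 + b * w ^ 2 = 0 := by
    have t0 : t ≠ 0 := by
      rintro rfl
      simp_all
    have hle {s : ℚ_[p]} (hs : ‖s‖ ≤ ‖t‖) : ‖s / t‖ ≤ 1 := by
      rw [norm_div]
      exact div_le_one_of_le₀ hs (norm_nonneg _)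
    refine ⟨⟨x / t, hle hx⟩, ⟨y / t, hle hy⟩, ⟨z / t, hle hz⟩, ?_, ?_⟩
    · rcases ht with rfl | rfl | rfl
      · exact Or.inl (Subtype.ext (div_self t0))
      · exact Or.inr (Or.inl (Subtype.ext (div_self t0)))
      · exact Or.inr (Or.inr (Subtype.ext (div_self t0)))
    · apply Subtype.ext
      change (x / t) ^ 2 + a * (y / t) ^ 2 + b * (z / t) ^ 2 = 0
      field_simp
      linear_combination h
  rcases le_total ‖x‖ ‖y‖ with h1 | h1 <;> rcases le_total ‖y‖ ‖z‖ with h2 | h2 <;>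
    rcases le_total ‖x‖ ‖z‖ with h3 | h3
  · exact key z h3 h2 le_rfl (by simp)
  · exact key z (h1.trans h2) h2 le_rfl (by simp)
  · exact key y h1 le_rfl h2 (by simp)
  · exact key y h1 le_rfl h2 (by simp)
  · exact key z h3 h2 le_rfl (by simp)
  · exact key x le_rfl h1 h3 (by simp)
  · exact key z h3 (h1.trans h3) le_rfl (by simp)
  · exact key x le_rfl h1 h3 (by simp)

theorem ZMod.not_isSquare_neg_three {p : ℕ} [Fact p.Prime] (h2 : p ≠ 2) (hp : p % 3 = 2) :
    ¬ IsSquare (-3 : ZMod p) := by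
  rintro ⟨a, ha⟩
  have h2' : (2 : ZMod p) ≠ 0 := by
    intro h
    have : p ∣ 2 := (ZMod.natCast_eq_zero_iff 2 p).1 (by exact_mod_cast h)
    exact h2 ((Nat.prime_dvd_prime_iff_eq Fact.out Nat.prime_two).1 this)
  have h3' : (3 : ZMod p) ≠ 0 := by
    intro h
    have : p ∣ 3 := (ZMod.natCast_eq_zero_iff 3 p).1 (by exact_mod_cast h)
    have := (Nat.prime_dvd_prime_iff_eq Fact.out Nat.prime_three).1 this
    omega
  have hw : ((-1 + a) / 2) ^ 3 = 1 := by
    field_simp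
    linear_combination (-a + 3) * ha
  have hne : (-1 + a) / 2 ≠ 1 := by
    intro h
    have h' : a = 3 := by
      field_simp at h
      linear_combination h
    subst h'
    have : (2 : ZMod p) * 2 * 3 = 0 := by linear_combination -ha
    simp_all
  have ho := orderOf_eq_prime hw hne
  have hd : orderOf ((-1 + a) / 2) ∣ p - 1 := by
    apply ZMod.orderOf_dvd_card_sub_one
    intro h
    rw [h] at hw
    simp at hw
  rw [ho] at hd
  omega

theorem Finset.prod_natCast_zmod_three {S : Finset ℕ} (h : ∀ q ∈ S, q % 3 = 2) :
    ((∏ q ∈ S, q : ℕ) : ZMod 3) = (-1) ^ S.card := by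
  push_cast
  apply Finset.prod_eq_pow_card
  intro q hq
  rw [← ZMod.natCast_mod, h q hq]
  decide

theorem mod_three_of_not_three_dvd {N : ℕ} (hsq : Squarefree N) (hodd : Odd N.primeFactors.card)
    (h3 : ∀ q : ℕ, q.Prime → q ∣ N → q % 3 ≠ 1)
    (h : ¬ 3 ∣ N) : N % 3 = 2 := by
  have := Finset.prod_natCast_zmod_three (S := N.primeFactors) (fun q hq => by
    have hq' := Nat.prime_of_mem_primeFactors hq
    have hd := Nat.dvd_of_mem_primeFactors hq
    have := h3 q hq' hd
    have : ¬ 3 ∣ q := fun h' => h (h'.trans hd)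
    omega)
  rw [Nat.prod_primeFactors_of_squarefree hsq, hodd.neg_one_pow] at this
  have h' : (N : ZMod 3) = (2 : ℕ) := by rw [this]; decide
  exact (ZMod.natCast_eq_natCast_iff' _ _ _).1 h'

theorem mod_nine_of_three_dvd {N : ℕ} (hsq : Squarefree N) (hodd : Odd N.primeFactors.card)
    (h3 : ∀ q : ℕ, q.Prime → q ∣ N → q % 3 ≠ 1)
    (h : 3 ∣ N) : N % 9 = 3 := by
  have hmem : 3 ∈ N.primeFactors :=
    Nat.mem_primeFactors.2 ⟨Nat.prime_three, h, hsq.ne_zero⟩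
  have := Finset.prod_natCast_zmod_three (S := N.primeFactors.erase 3) (fun q hq => by
    obtain ⟨hq3, hq⟩ := Finset.mem_erase.1 hq
    have hq' := Nat.prime_of_mem_primeFactors hq
    have := h3 q hq' (Nat.dvd_of_mem_primeFactors hq)
    have : ¬ 3 ∣ q := fun h' => hq3 ((Nat.prime_dvd_prime_iff_eq Nat.prime_three hq').1 h').symm
    omega)
  rw [Finset.card_erase_of_mem hmem, (Nat.Odd.sub_odd hodd odd_one).neg_one_pow] at this
  have h' := (ZMod.natCast_eq_natCast_iff' _ 1 3).1 (by rw [this, Nat.cast_one])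
  have hN := Finset.mul_prod_erase N.primeFactors (fun q => q) hmem
  rw [Nat.prod_primeFactors_of_squarefree hsq] at hN
  omega

theorem quaternion_neg_three_neg_N_ramified_iff (N : ℕ) (hNpos : 0 < N)
    (hsq : Squarefree N) (hodd : Odd N.primeFactors.card)
    (h3 : ∀ q : ℕ, q.Prime → q ∣ N → q % 3 ≠ 1)
    (p : ℕ) [Fact p.Prime] :
    (∃ x y z : ℚ_[p], (x, y, z) ≠ (0, 0, 0) ∧
        x ^ 2 + 3 * y ^ 2 + (N : ℚ_[p]) * z ^ 2 = 0) ↔ ¬ (p ∣ N) := by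
  have hp : p.Prime := Fact.out
  constructor
  · rintro ⟨x, y, z, h0, h⟩ hpN
    obtain ⟨u, v, w, h1, h⟩ := exists_primitive_of_isotropic (a := 3) (b := N) h0
      (by push_cast; exact h)
    by_cases hp2 : p = 2
    · subst hp2
      have h4 : ¬ 2 * 2 ∣ N := fun h' => by simpa using hsq 2 h'
      have hN : N % 8 = 2 ∨ N % 8 = 6 := by omega
      have hN' : (N : ZMod (2 ^ 3)) = 2 ∨ (N : ZMod (2 ^ 3)) = 6 := by
        rw [← ZMod.natCast_mod]
        exact hN.imp (fun h => by norm_num [h]) (fun h => by norm_num [h])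
      have hm := congrArg (PadicInt.toZModPow (p := 2) 3) h
      have key : ∀ n u v w : ZMod (2 ^ 3), (n = 2 ∨ n = 6) → (u = 1 ∨ v = 1 ∨ w = 1) →
          u ^ 2 + 3 * v ^ 2 + n * w ^ 2 ≠ 0 := by decide +kernel
      refine key N _ _ _ hN' ?_
        (by simpa only [map_add, map_mul, map_pow, map_natCast, map_ofNat, map_zero] using hm)
      rcases h1 with rfl | rfl | rfl <;> simp
    by_cases hp3 : p = 3
    · subst hp3
      have hN := mod_nine_of_three_dvd hsq hodd h3 hpN
      have hN' : (N : ZMod (3 ^ 2)) = 3 := by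
        rw [← ZMod.natCast_mod]
        norm_num [hN]
      have hm := congrArg (PadicInt.toZModPow (p := 3) 2) h
      have key : ∀ u v w : ZMod (3 ^ 2), (u = 1 ∨ v = 1 ∨ w = 1) →
          u ^ 2 + 3 * v ^ 2 + 3 * w ^ 2 ≠ 0 := by decide +kernel
      refine key _ _ _ ?_
        (by simpa only [map_add, map_mul, map_pow, map_natCast, map_ofNat, map_zero, hN'] using hm)
      rcases h1 with rfl | rfl | rfl <;> simp
    have hpm : p % 3 = 2 := by
      have := h3 p hp hpN
      have : ¬ 3 ∣ p := fun h' => hp3 ((Nat.prime_dvd_prime_iff_eq Nat.prime_three hp).1 h').symm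
      omega
    have hm := congrArg (PadicInt.toZMod (p := p)) h
    have hN0 : (N : ZMod p) = 0 := (ZMod.natCast_eq_zero_iff N p).2 hpN
    simp only [map_add, map_mul, map_pow, map_natCast, map_ofNat, map_zero, hN0, zero_mul,
      add_zero] at hm
    have hv : PadicInt.toZMod v = 0 := by
      by_contra hv
      refine ZMod.not_isSquare_neg_three hp2 hpm
        ⟨PadicInt.toZMod u / PadicInt.toZMod v, ?_⟩
      field_simp
      linear_combination -hm
    have hu : PadicInt.toZMod u = 0 := by simpa [hv] using hm
    have hw : w = 1 := by
      rcases h1 with rfl | rfl | rfl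
      · simp at hu
      · simp at hv
      · rfl
    have hdvd {t : ℤ_[p]} (ht : PadicInt.toZMod t = 0) : (p : ℤ_[p]) ∣ t := by
      rwa [← RingHom.mem_ker, PadicInt.ker_toZMod, PadicInt.maximalIdeal_eq_span_p,
        Ideal.mem_span_singleton] at ht
    obtain ⟨c, rfl⟩ := hdvd hu
    obtain ⟨d, rfl⟩ := hdvd hv
    subst hw
    have hd : ((p : ℤ_[p]) ^ 2) ∣ ((N : ℤ) : ℤ_[p]) :=
      ⟨-(c ^ 2 + 3 * d ^ 2), by push_cast; linear_combination h⟩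
    rw [← Ideal.mem_span_singleton, ← PadicInt.norm_le_pow_iff_mem_span_pow,
      PadicInt.norm_int_le_pow_iff_dvd] at hd
    have hd' : p * p ∣ N := by
      rw [← sq]
      exact_mod_cast hd
    exact hp.not_isUnit (hsq p hd')
  · intro hpN
    by_cases hp2 : p = 2
    · subst hp2
      have h2n : ‖(2 : ℤ_[2])‖ = 1 / 2 := by
        have := PadicInt.norm_p (p := 2)
        simpa using this
      have hone {k : ℤ} (hk : ¬ 2 ∣ k) : ‖(k : ℤ_[2])‖ = 1 := by
        refine le_antisymm (PadicInt.norm_le_one _) (not_lt.1 fun h => hk ?_)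
        exact_mod_cast PadicInt.norm_int_lt_one_iff_dvd k |>.1 h
      have hlt {k l : ℤ} (hk : 8 ∣ k) (hl : ¬ 2 ∣ l) :
          ‖(k : ℤ_[2])‖ < ‖(2 * l : ℤ_[2])‖ ^ 2 := by
        have := (PadicInt.norm_int_le_pow_iff_dvd (p := 2) (k := k) (n := 3)).2 (by exact_mod_cast hk)
        rw [norm_mul, h2n, hone hl]
        refine this.trans_lt ?_
        norm_num
      have h31 : ‖(3 : ℤ_[2])‖ = 1 := by exact_mod_cast hone (k := 3) (by norm_num)
      have : N % 8 = 1 ∨ N % 8 = 3 ∨ N % 8 = 5 ∨ N % 8 = 7 := by omega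
      rcases this with h | h | h | h
      · exact exists_isotropic_of_norm_lt_right (x := 2) (y := 1) h31 (hlt (by omega) (by omega))
      · exact exists_isotropic_of_norm_lt_left (x := 1) (y := 2) (hlt (by omega) (by omega))
      · exact exists_isotropic_of_norm_lt_right (x := 0) (y := 1) h31 (hlt (by omega) (by omega))
      · exact exists_isotropic_of_norm_lt_left (x := 1) (y := 0) (hlt (by omega) (by omega))
    have hone {k : ℤ} (hk : ¬ (p : ℤ) ∣ k) : ‖(k : ℤ_[p])‖ = 1 :=
      le_antisymm (PadicInt.norm_le_one _)
        (not_lt.1 fun h => hk (PadicInt.norm_int_lt_one_iff_dvd k |>.1 h))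
    have h2n : ‖(2 : ℤ_[p])‖ = 1 := by
      refine mod_cast hone (k := 2) fun h => hp2 ?_
      exact (Nat.prime_dvd_prime_iff_eq hp Nat.prime_two).1 (by exact_mod_cast h)
    have hlt {k l : ℤ} (hk : (p : ℤ) ∣ k) (hl : ¬ (p : ℤ) ∣ l) :
        ‖(k : ℤ_[p])‖ < ‖(2 * l : ℤ_[p])‖ ^ 2 := by
      rw [norm_mul, h2n, hone hl]
      simpa using PadicInt.norm_int_lt_one_iff_dvd k |>.2 hk
    by_cases hp3 : p = 3
    · subst hp3
      have := mod_three_of_not_three_dvd hsq hodd h3 hpN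
      exact exists_isotropic_of_norm_lt_left (x := 1) (y := 0)
        (hlt (by push_cast; omega) (by norm_num))
    have h3n : ‖(3 : ℤ_[p])‖ = 1 := by
      refine mod_cast hone (k := 3) fun h => hp3 ?_
      exact (Nat.prime_dvd_prime_iff_eq hp Nat.prime_three).1 (by exact_mod_cast h)
    have h30 : (3 : ZMod p) ≠ 0 := by
      intro h
      have : p ∣ 3 := (ZMod.natCast_eq_zero_iff 3 p).1 (by exact_mod_cast h)
      exact hp3 ((Nat.prime_dvd_prime_iff_eq hp Nat.prime_three).1 this)
    obtain ⟨a, b, hab⟩ := FiniteField.exists_root_sum_quadratic (R := ZMod p)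
      (f := Polynomial.X ^ 2) (g := Polynomial.C 3 * Polynomial.X ^ 2 + Polynomial.C (N : ZMod p))
      (by simp) (by compute_degree!)
      (by rw [ZMod.card]; exact Nat.odd_iff.1 (hp.odd_of_ne_two hp2))
    obtain ⟨x, rfl⟩ := ZMod.intCast_surjective a
    obtain ⟨y, rfl⟩ := ZMod.intCast_surjective b
    have hxy : (p : ℤ) ∣ x ^ 2 + 3 * y ^ 2 + N := by
      rw [← ZMod.intCast_zmod_eq_zero_iff_dvd]
      simp only [Polynomial.eval_add, Polynomial.eval_mul, Polynomial.eval_pow,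
        Polynomial.eval_X, Polynomial.eval_C] at hab
      push_cast
      linear_combination hab
    by_cases hx : (p : ℤ) ∣ x
    · by_cases hy : (p : ℤ) ∣ y
      · refine absurd ?_ hpN
        have : (p : ℤ) ∣ x ^ 2 + 3 * y ^ 2 :=
          dvd_add (dvd_pow hx two_ne_zero) ((dvd_pow hy two_ne_zero).mul_left 3)
        exact_mod_cast (dvd_add_right this).1 hxy
      · exact exists_isotropic_of_norm_lt_right h3n (hlt hxy hy)
    · exact exists_isotropic_of_norm_lt_left (hlt hxy hx)
end

section
/- Let p be a prime with p ≡ 1 (mod 4), and let a, b be nonzero elements of ℚ_p such that the only solution in ℚ_p of z² = a·x² + b·y² is x = y = z = 0. Then there exist no x₁, x₂, x₃ ∈ ℚ_p with −a·x₁² − b·x₂² + a·b·x₃² = 1. (In other words, if the quaternion algebra (a, b / ℚ_p) is a division algebra and p ≡ 1 mod 4, then it contains no element of reduced trace 0 and reduced norm 1.) -/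
/-- In `ℚ_p` with `p ≡ 1 mod 4`, `-1` is a square. -/
theorem Padic.isSquare_neg_one {p : ℕ} [Fact p.Prime] (hp : p % 4 = 1) :
    IsSquare (-1 : ℚ_[p]) := by
  obtain ⟨k, hk⟩ := (ZMod.exists_sq_eq_neg_one_iff (p := p)).2 (by omega)
  obtain ⟨n, rfl⟩ := ZMod.intCast_surjective k
  have hdvd : (p : ℤ) ∣ n ^ 2 + 1 := by
    rw [← ZMod.intCast_zmod_eq_zero_iff_dvd]
    push_cast
    linear_combination -hk
  have hprime : Prime (p : ℤ) := Nat.prime_iff_prime_int.mp Fact.out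
  have hndvd : ¬ (p : ℤ) ∣ 2 * n := by
    intro h
    rcases hprime.dvd_or_dvd h with h | h
    · have := Int.le_of_dvd two_pos h
      have := (Fact.out : p.Prime).two_le
      omega
    · refine hprime.not_dvd_one ?_
      have := dvd_sub hdvd (h.mul_left n)
      ring_nf at this
      exact this
  have hval : ‖((n ^ 2 + 1 : ℤ) : ℤ_[p])‖ < 1 :=
    PadicInt.norm_intCast_lt_one_iff.mpr hdvd
  have hder : ‖((2 * n : ℤ) : ℤ_[p])‖ = 1 :=
    (PadicInt.norm_le_one _).antisymm
      (not_lt.mp (mt PadicInt.norm_intCast_lt_one_iff.mp hndvd))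
  obtain ⟨z, hz, -⟩ := hensels_lemma (p := p)
    (F := (Polynomial.X ^ 2 + 1 : Polynomial ℤ_[p])) (a := (n : ℤ_[p])) (by
      push_cast at hval hder
      simpa [one_add_one_eq_two, hder] using hval)
  have hz' : z ^ 2 + 1 = 0 := by simpa using hz
  have hzq : (z : ℚ_[p]) ^ 2 + 1 = 0 := by exact_mod_cast congrArg ((↑) : ℤ_[p] → ℚ_[p]) hz'
  exact ⟨z, by linear_combination -hzq⟩

theorem no_trace_zero_norm_one_of_division (p : ℕ) [Fact p.Prime]
    (hp4 : p % 4 = 1) (a b : ℚ_[p]) (ha : a ≠ 0) (hb : b ≠ 0)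
    (hdiv : ∀ x y z : ℚ_[p], z ^ 2 = a * x ^ 2 + b * y ^ 2 →
      x = 0 ∧ y = 0 ∧ z = 0) :
    ¬ ∃ x₁ x₂ x₃ : ℚ_[p], -a * x₁ ^ 2 - b * x₂ ^ 2 + a * b * x₃ ^ 2 = 1 := by
  rintro ⟨x, y, w, h⟩
  obtain ⟨i, hi⟩ := Padic.isSquare_neg_one hp4
  obtain ⟨-, hN, -⟩ := hdiv (i * w + x * y) (y ^ 2 - a * w ^ 2) (i * y + a * x * w) (by
    linear_combination -(y ^ 2 - a * w ^ 2) * (hi - h))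
  obtain ⟨rfl, -, rfl⟩ := hdiv w 0 y (by linear_combination hN)
  obtain ⟨-, -, rfl⟩ := hdiv x 0 i (by linear_combination h - hi)
  simp at hi
end

section
/- Let p be a prime with p ≡ 1 (mod 3), and let a, b be nonzero elements of ℚ_p such that the only solution in ℚ_p of z² = a·x² + b·y² is x = y = z = 0. Then there exist no x₁, x₂, x₃ ∈ ℚ_p with −a·x₁² − b·x₂² + a·b·x₃² = 3. (In other words, if the quaternion algebra (a, b / ℚ_p) is a division algebra and p ≡ 1 mod 3, then it contains no element of reduced trace 0 and reduced norm 3; equivalently, no element of reduced trace 1 and reduced norm 1.) -/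
theorem ZMod.exists_sq_add_self_add_one_eq_zero (p : ℕ) [Fact p.Prime] (hp3 : p % 3 = 1) :
    ∃ w : ZMod p, w ^ 2 + w + 1 = 0 := by
  have hcard : 3 ∣ Fintype.card (ZMod p)ˣ := by
    rw [ZMod.card_units]
    omega
  have : Fact (Nat.Prime 3) := ⟨Nat.prime_three⟩
  obtain ⟨u, hu⟩ := exists_prime_orderOf_dvd_card 3 hcard
  have h3 : (u : ZMod p) ^ 3 = 1 := by
    have := pow_orderOf_eq_one u
    rw [hu] at this
    rw [← Units.val_pow_eq_pow_val, this, Units.val_one]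
  have h1 : (u : ZMod p) ≠ 1 := by
    intro h
    rw [Units.val_eq_one] at h
    simp [h] at hu
  refine ⟨u, mul_left_cancel₀ (sub_ne_zero.mpr h1) ?_⟩
  linear_combination h3

theorem PadicInt.exists_sq_add_self_add_one_eq_zero (p : ℕ) [Fact p.Prime] (hp3 : p % 3 = 1) :
    ∃ w : ℤ_[p], w ^ 2 + w + 1 = 0 := by
  obtain ⟨w, hw⟩ := ZMod.exists_sq_add_self_add_one_eq_zero p hp3
  obtain ⟨m, rfl⟩ := ZMod.intCast_surjective w
  have hdvd : (p : ℤ) ∣ m ^ 2 + m + 1 := by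
    rw [← ZMod.intCast_zmod_eq_zero_iff_dvd]
    exact_mod_cast hw
  have hndvd : ¬ (p : ℤ) ∣ 2 * m + 1 := by
    intro h
    have h3 : (p : ℤ) ∣ 3 := by
      have h4 := dvd_sub (hdvd.mul_left 4) (h.mul_left (2 * m + 1))
      ring_nf at h4
      exact h4
    have h3' : p ∣ 3 := by exact_mod_cast h3
    have := (Nat.prime_dvd_prime_iff_eq (Fact.out : p.Prime) Nat.prime_three).mp h3'
    omega
  have hlt : ‖((m ^ 2 + m + 1 : ℤ) : ℤ_[p])‖ < 1 := PadicInt.norm_int_lt_one_iff_dvd _ |>.mpr hdvd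
  have heq : ‖((2 * m + 1 : ℤ) : ℤ_[p])‖ = 1 :=
    le_antisymm (PadicInt.norm_le_one _)
      (not_lt.mp fun h => hndvd ((PadicInt.norm_int_lt_one_iff_dvd _).mp h))
  push_cast at hlt heq
  obtain ⟨z, hz, -⟩ := hensels_lemma (p := p)
    (F := (Polynomial.X ^ 2 + Polynomial.X + 1 : Polynomial ℤ_[p])) (a := (m : ℤ_[p]))
    (by simpa [one_add_one_eq_two, heq] using hlt)
  exact ⟨z, by simpa using hz⟩

theorem Padic.exists_sq_eq_neg_three (p : ℕ) [Fact p.Prime] (hp3 : p % 3 = 1) :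
    ∃ s : ℚ_[p], s ^ 2 = -3 := by
  obtain ⟨w, hw⟩ := PadicInt.exists_sq_add_self_add_one_eq_zero p hp3
  have hw' : (w : ℚ_[p]) ^ 2 + w + 1 = 0 := by exact_mod_cast congrArg ((↑) : ℤ_[p] → ℚ_[p]) hw
  exact ⟨2 * w + 1, by linear_combination 4 * hw'⟩

theorem no_trace_zero_norm_three_of_division (p : ℕ) [Fact p.Prime]
    (hp3 : p % 3 = 1) (a b : ℚ_[p]) (ha : a ≠ 0) (hb : b ≠ 0)
    (hdiv : ∀ x y z : ℚ_[p], z ^ 2 = a * x ^ 2 + b * y ^ 2 →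
      x = 0 ∧ y = 0 ∧ z = 0) :
    ¬ ∃ x₁ x₂ x₃ : ℚ_[p], -a * x₁ ^ 2 - b * x₂ ^ 2 + a * b * x₃ ^ 2 = 3 := by
  rintro ⟨x₁, x₂, x₃, h⟩
  obtain ⟨s, hs⟩ := Padic.exists_sq_eq_neg_three p hp3
  obtain ⟨-, hy, -⟩ := hdiv (s * x₃ + x₁ * x₂) (x₂ ^ 2 - a * x₃ ^ 2) (s * x₂ + a * x₁ * x₃)
    (by linear_combination (x₂ ^ 2 - a * x₃ ^ 2) * (h + hs))
  obtain ⟨-, -, hs0⟩ := hdiv x₁ 0 s (by linear_combination h + hs + b * hy)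
  rw [hs0] at hs
  norm_num at hs
end

section
/- For all λ, μ ∈ ℚ₂, if ‖λ² + μ²‖ ≤ 1 then ‖λ‖ ≤ 1 and ‖μ‖ ≤ 1; that is, if λ² + μ² lies in ℤ₂ then both λ and μ lie in ℤ₂. (This is the p = 2 case of the statement that the ring of integers of ℚ₂(√−1) is ℤ₂[√−1].) -/
theorem PadicInt.not_four_dvd_one_add_sq (t : ℤ_[2]) : ¬ 4 ∣ 1 + t ^ 2 := by
  rintro ⟨c, hc⟩
  have h := congrArg (PadicInt.toZModPow 2) hc
  simp only [map_add, map_one, map_pow, map_mul, map_ofNat] at h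
  generalize PadicInt.toZModPow 2 t = a at h
  generalize PadicInt.toZModPow 2 c = b at h
  revert a b
  decide

theorem Padic.norm_le_one_of_norm_sq_add_sq_le_one {l m : ℚ_[2]} (hml : ‖m‖ ≤ ‖l‖)
    (h : ‖l ^ 2 + m ^ 2‖ ≤ 1) : ‖l‖ ≤ 1 := by
  by_contra! hl
  have hl0 : l ≠ 0 := norm_pos_iff.mp (one_pos.trans hl)
  have ht : ‖m / l‖ ≤ 1 := by
    rw [norm_div]
    exact div_le_one_of_le₀ hml (norm_nonneg l)
  have hinv : ‖l⁻¹‖ < 1 := by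
    rw [norm_inv]
    exact inv_lt_one_of_one_lt₀ hl
  obtain ⟨s, hs⟩ := (PadicInt.norm_lt_one_iff_dvd (⟨l⁻¹, hinv.le⟩ : ℤ_[2])).mp hinv
  have hs' : l⁻¹ = 2 * (s : ℚ_[2]) := congrArg Subtype.val hs
  refine PadicInt.not_four_dvd_one_add_sq ⟨m / l, ht⟩ ⟨s ^ 2 * ⟨l ^ 2 + m ^ 2, h⟩, ?_⟩
  apply Subtype.ext
  change 1 + (m / l) ^ 2 = 4 * ((s : ℚ_[2]) ^ 2 * (l ^ 2 + m ^ 2))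
  calc 1 + (m / l) ^ 2 = l⁻¹ ^ 2 * (l ^ 2 + m ^ 2) := by field_simp
    _ = 4 * ((s : ℚ_[2]) ^ 2 * (l ^ 2 + m ^ 2)) := by rw [hs']; ring

theorem two_adic_integral_of_sum_sq_integral :
    ∀ l m : ℚ_[2], ‖l ^ 2 + m ^ 2‖ ≤ 1 → ‖l‖ ≤ 1 ∧ ‖m‖ ≤ 1 := by
  intro l m h
  rcases le_total ‖m‖ ‖l‖ with hml | hlm
  · have hl := Padic.norm_le_one_of_norm_sq_add_sq_le_one hml h
    exact ⟨hl, hml.trans hl⟩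
  · have hm := Padic.norm_le_one_of_norm_sq_add_sq_le_one hlm (by rwa [add_comm])
    exact ⟨hlm.trans hm, hm⟩
end

section
/- Let p be a prime and let u, v ∈ ℚ_p satisfy ‖u‖ = ‖v‖ = ‖u − v‖ = 1. Let γ be the diagonal 2×2 matrix with diagonal entries u, v, and let h be an invertible 2×2 matrix over ℚ_p. Then every entry of h⁻¹·γ·h has norm ≤ 1 if and only if there exist nonzero s₁, s₂ ∈ ℚ_p and a 2×2 matrix k over ℚ_p with all entries of norm ≤ 1 and ‖det k‖ = 1 such that h = diag(s₁, s₂)·k. (That is, h⁻¹γh ∈ GL₂(ℤ_p) if and only if h lies in T(ℚ_p)·GL₂(ℤ_p), where T is the diagonal torus.) -/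
theorem Padic.norm_sub_le_max {p : ℕ} [Fact p.Prime] (x y : ℚ_[p]) :
    ‖x - y‖ ≤ max ‖x‖ ‖y‖ := by
  simpa [sub_eq_add_neg] using IsUltrametricDist.norm_add_le_max x (-y)

theorem Padic.norm_add_mul_le_one_iff {p : ℕ} [Fact p.Prime] {t w : ℚ_[p]} (ht : ‖t‖ ≤ 1)
    (hw : ‖w‖ = 1) (x : ℚ_[p]) : ‖t + w * x‖ ≤ 1 ↔ ‖x‖ ≤ 1 := by
  have hx : ‖w * x‖ = ‖x‖ := by rw [norm_mul, hw, one_mul]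
  constructor
  · intro H
    have := Padic.norm_sub_le_max (t + w * x) t
    rw [add_sub_cancel_left, hx] at this
    exact this.trans (max_le H ht)
  · intro H
    exact (IsUltrametricDist.norm_add_le_max t (w * x)).trans (max_le ht (hx.trans_le H))

theorem Matrix.inv_mul_diagonal_mul_fin_two {K : Type*} [Field K] (u v : K)
    (h : Matrix (Fin 2) (Fin 2) K) (hh : h.det ≠ 0) :
    h⁻¹ * Matrix.diagonal ![u, v] * h =
      !![v + (u - v) * (h 0 0 * h 1 1 / h.det), 0 + (u - v) * (h 0 1 * h 1 1 / h.det);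
        0 + (v - u) * (h 0 0 * h 1 0 / h.det), v + (v - u) * (h 0 1 * h 1 0 / h.det)] := by
  have hD := Matrix.det_fin_two h
  rw [Matrix.inv_def, Ring.inverse_eq_inv', Matrix.adjugate_fin_two]
  ext i j
  rw [Matrix.mul_apply, Fin.sum_univ_two, Matrix.mul_diagonal, Matrix.mul_diagonal]
  fin_cases i <;> fin_cases j <;> simp <;> field_simp <;> (try rw [hD]) <;> ring

theorem Matrix.forall_norm_conj_diagonal_le_one_iff {p : ℕ} [Fact p.Prime]
    {u v : ℚ_[p]} (hv : ‖v‖ = 1) (huv : ‖u - v‖ = 1)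
    (h : Matrix (Fin 2) (Fin 2) ℚ_[p]) (hh : h.det ≠ 0) :
    (∀ i j, ‖(h⁻¹ * Matrix.diagonal ![u, v] * h) i j‖ ≤ 1) ↔
      ∀ i j, ‖h 0 i * h 1 j‖ ≤ ‖h.det‖ := by
  have hvu : ‖v - u‖ = 1 := by rw [norm_sub_rev, huv]
  have h0 : ‖(0 : ℚ_[p])‖ ≤ 1 := by simp
  have hpos : 0 < ‖h.det‖ := norm_pos_iff.mpr hh
  have key (x : ℚ_[p]) : ‖x / h.det‖ ≤ 1 ↔ ‖x‖ ≤ ‖h.det‖ := by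
    rw [norm_div, div_le_one hpos]
  rw [Matrix.inv_mul_diagonal_mul_fin_two u v h hh]
  simp only [Fin.forall_fin_two, Matrix.of_apply, Matrix.cons_val_zero, Matrix.cons_val_one,
    Padic.norm_add_mul_le_one_iff hv.le huv, Padic.norm_add_mul_le_one_iff h0 huv,
    Padic.norm_add_mul_le_one_iff hv.le hvu, Padic.norm_add_mul_le_one_iff h0 hvu, key]
  tauto

theorem conj_diagonal_integral_iff (p : ℕ) [Fact p.Prime]
    (u v : ℚ_[p]) (hu : ‖u‖ = 1) (hv : ‖v‖ = 1) (huv : ‖u - v‖ = 1)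
    (h : Matrix (Fin 2) (Fin 2) ℚ_[p]) (hh : IsUnit h.det) :
    (∀ i j, ‖(h⁻¹ * Matrix.diagonal ![u, v] * h) i j‖ ≤ 1) ↔
      ∃ s₁ s₂ : ℚ_[p], s₁ ≠ 0 ∧ s₂ ≠ 0 ∧
        ∃ k : Matrix (Fin 2) (Fin 2) ℚ_[p],
          (∀ i j, ‖k i j‖ ≤ 1) ∧ ‖k.det‖ = 1 ∧
            h = Matrix.diagonal ![s₁, s₂] * k := by
  have hD : h.det ≠ 0 := hh.ne_zero
  rw [Matrix.forall_norm_conj_diagonal_le_one_iff hv huv h hD]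
  constructor
  · intro H
    have row (r : Fin 2) : ∃ i, h r i ≠ 0 ∧ ∀ j, ‖h r j‖ ≤ ‖h r i‖ := by
      obtain ⟨i, hi⟩ := Finite.exists_max fun j => ‖h r j‖
      refine ⟨i, fun h0 => hD (Matrix.det_eq_zero_of_row_eq_zero r fun j => ?_), hi⟩
      simpa [h0] using hi j
    obtain ⟨i, hi0, hi⟩ := row 0
    obtain ⟨j, hj0, hj⟩ := row 1
    have hk : h = Matrix.diagonal ![h 0 i, h 1 j] *
        Matrix.of ![fun l => h 0 l / h 0 i, fun l => h 1 l / h 1 j] := by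
      ext r l
      fin_cases r <;> simp [Matrix.diagonal_mul] <;> field_simp
    refine ⟨h 0 i, h 1 j, hi0, hj0, _, ?_, ?_, hk⟩
    · intro r l
      fin_cases r
      · simpa using div_le_one_of_le₀ (hi l) (norm_nonneg _)
      · simpa using div_le_one_of_le₀ (hj l) (norm_nonneg _)
    · have hdet : h.det = h 0 i * h 1 j *
          (Matrix.of ![fun l => h 0 l / h 0 i, fun l => h 1 l / h 1 j]).det := by
        conv_lhs => rw [hk]
        simp [Matrix.det_mul, Matrix.det_diagonal]
      have hle : ‖h.det‖ ≤ ‖h 0 i * h 1 j‖ := by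
        rw [Matrix.det_fin_two]
        refine (Padic.norm_sub_le_max _ _).trans (max_le ?_ ?_) <;>
          rw [norm_mul, norm_mul]
        · exact mul_le_mul (hi 0) (hj 1) (norm_nonneg _) (norm_nonneg _)
        · exact mul_le_mul (hi 1) (hj 0) (norm_nonneg _) (norm_nonneg _)
      have heq := le_antisymm hle (H i j)
      rw [hdet, norm_mul] at heq
      exact (mul_eq_left₀ (norm_ne_zero_iff.mpr (mul_ne_zero hi0 hj0))).mp heq
  · rintro ⟨s₁, s₂, -, -, k, hk, hdet, rfl⟩ i j
    have hs : ‖(Matrix.diagonal ![s₁, s₂] * k).det‖ = ‖s₁‖ * ‖s₂‖ := by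
      simp [Matrix.det_mul, Matrix.det_diagonal, hdet]
    rw [hs]
    simp only [Matrix.diagonal_mul, Matrix.cons_val_zero, Matrix.cons_val_one, norm_mul]
    exact mul_le_mul (mul_le_of_le_one_right (norm_nonneg _) (hk 0 i))
      (mul_le_of_le_one_right (norm_nonneg _) (hk 1 j)) (by positivity) (norm_nonneg _)
end

section
/- Let k ≥ 1 and n = 2k−2. For every integer i with 0 ≤ i ≤ n, the weighted coefficient pairing ∑_{a₁=0}^{n} ∑_{a₂=0}^{n} C(n,a₁)⁻¹ · C(n,a₂)⁻¹ · C(n,i)⁻¹ · w(a₁, a₂) · C_{a₁, a₂, i} equals ((k−1)!)³ · (3k−2)! / ( ((2k−2)!)² · (2k−1)! ) if i = 0, and equals 0 if i ≠ 0. Here w(a₁, a₂) denotes the coefficient in w°_{2k} of the monomial X₁^{n−a₁} Y₁^{a₁} X₂^{n−a₂} Y₂^{a₂}. (This expresses that ⟨w°_{2k} ⊗ X₃^{n−i}Y₃^{i}, P_{2k}⟩ = ‖w°_{2k}‖² when i = 0 and vanishes otherwise, for the invariant inner product in which the monomials X^{a}Y^{n−a} are orthogonal with squared length C(n,a)⁻¹.)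 -/
open MvPolynomial

/-- The polynomial `P_{2k} = (X₁Y₂ − X₂Y₁)^{k−1} (X₂Y₃ − X₃Y₂)^{k−1} (X₃Y₁ − X₁Y₃)^{k−1}`
in the variables `X 0 = X₁, X 1 = Y₁, X 2 = X₂, X 3 = Y₂, X 4 = X₃, X 5 = Y₃`. -/
noncomputable def P2k (k : ℕ) : MvPolynomial (Fin 6) ℚ :=
  (X 0 * X 3 - X 2 * X 1) ^ (k - 1) * (X 2 * X 5 - X 4 * X 3) ^ (k - 1) *
    (X 4 * X 1 - X 0 * X 5) ^ (k - 1)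

/-- The coefficient `C_{i,j,r}` in `P_{2k}` of
`X₁^{2k−2−i} Y₁^{i} X₂^{2k−2−j} Y₂^{j} X₃^{2k−2−r} Y₃^{r}`. -/
noncomputable def Ccoeff (k i j r : ℕ) : ℚ :=
  MvPolynomial.coeff
    (Finsupp.equivFunOnFinite.symm ![2 * k - 2 - i, i, 2 * k - 2 - j, j, 2 * k - 2 - r, r])
    (P2k k)

/-- The polynomial `w°_{2k} = (−Y₁Y₂(X₁Y₂ − X₂Y₁))^{k−1}` in the variables
`X 0 = X₁, X 1 = Y₁, X 2 = X₂, X 3 = Y₂`. -/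
noncomputable def w2k (k : ℕ) : MvPolynomial (Fin 4) ℚ :=
  (-(X 1) * X 3 * (X 0 * X 3 - X 2 * X 1)) ^ (k - 1)

/-- The coefficient `w(a₁, a₂)` in `w°_{2k}` of `X₁^{2k−2−a₁} Y₁^{a₁} X₂^{2k−2−a₂} Y₂^{a₂}`. -/
noncomputable def wcoeff (k a₁ a₂ : ℕ) : ℚ :=
  MvPolynomial.coeff
    (Finsupp.equivFunOnFinite.symm ![2 * k - 2 - a₁, a₁, 2 * k - 2 - a₂, a₂]) (w2k k)

/-- A Vandermonde identity for the coefficients of `(1 - X)⁻¹ ^ (p + 1)`. -/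
theorem sum_choose_add_mul_choose_add (p q n : ℕ) :
    ∑ j ∈ Finset.range (n + 1), (p + j).choose p * (q + (n - j)).choose q
      = (p + q + 1 + n).choose (p + q + 1) := by
  have h := congrArg (fun u : (PowerSeries ℤ)ˣ => PowerSeries.coeff n u.val)
    (PowerSeries.invOneSubPow_add ℤ (p + 1) (q + 1))
  rw [show p + 1 + (q + 1) = p + q + 1 + 1 by ring] at h
  simp only [Units.val_mul, PowerSeries.invOneSubPow_val_succ_eq_mk_add_choose,
    PowerSeries.coeff_mul, PowerSeries.coeff_mk,
    Finset.Nat.sum_antidiagonal_eq_sum_range_succ_mk] at h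
  exact_mod_cast h.symm

/-- Every monomial of `w°_{2k}` has total degree `3k − 3` in `Y₁, Y₂`. -/
theorem wcoeff_eq_zero_of_add_ne {m a b : ℕ} (h : a + b ≠ 3 * m) : wcoeff (m + 1) a b = 0 := by
  have hX (i : Fin 4) := isWeightedHomogeneous_X ℚ (![0, 1, 0, 1] : Fin 4 → ℕ) i
  have hY : IsWeightedHomogeneous (![0, 1, 0, 1] : Fin 4 → ℕ) (-(X 1) : MvPolynomial (Fin 4) ℚ) 1 :=
    (weightedHomogeneousSubmodule ℚ _ 1).neg_mem (hX 1)
  have hD : IsWeightedHomogeneous (![0, 1, 0, 1] : Fin 4 → ℕ)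
      (X 0 * X 3 - X 2 * X 1 : MvPolynomial (Fin 4) ℚ) 1 :=
    (weightedHomogeneousSubmodule ℚ _ 1).sub_mem ((hX 0).mul (hX 3)) ((hX 2).mul (hX 1))
  refine (((hY.mul (hX 3)).mul hD).pow m).coeff_eq_zero _ ?_
  simp [Finsupp.weight_apply, Finsupp.sum_fintype, Fin.sum_univ_four]
  omega

/-- Every monomial of `P_{2k}` has total degree `3k − 3` in `Y₁, Y₂, Y₃`. -/
theorem Ccoeff_eq_zero_of_add_ne {m a b r : ℕ} (h : a + b + r ≠ 3 * m) :
    Ccoeff (m + 1) a b r = 0 := by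
  have hX (i : Fin 6) := isWeightedHomogeneous_X ℚ (![0, 1, 0, 1, 0, 1] : Fin 6 → ℕ) i
  have hD (i j s t : Fin 6) (hij : (![0, 1, 0, 1, 0, 1] : Fin 6 → ℕ) i + ![0, 1, 0, 1, 0, 1] j = 1)
      (hst : (![0, 1, 0, 1, 0, 1] : Fin 6 → ℕ) s + ![0, 1, 0, 1, 0, 1] t = 1) :
      IsWeightedHomogeneous (![0, 1, 0, 1, 0, 1] : Fin 6 → ℕ)
        (X i * X j - X s * X t : MvPolynomial (Fin 6) ℚ) 1 :=
    (weightedHomogeneousSubmodule ℚ _ 1).sub_mem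
      (by simpa only [hij, mem_weightedHomogeneousSubmodule] using (hX i).mul (hX j))
      (by simpa only [hst, mem_weightedHomogeneousSubmodule] using (hX s).mul (hX t))
  refine ((((hD 0 3 2 1 rfl rfl).pow m).mul ((hD 2 5 4 3 rfl rfl).pow m)).mul
    ((hD 4 1 0 5 rfl rfl).pow m)).coeff_eq_zero _ ?_
  simp [Finsupp.weight_apply, Finsupp.sum_fintype, Fin.sum_univ_six]
  omega

/-- The part of `P_{2k}` free of `Y₃` is `w°_{2k} X₃^{2k−2}`. -/
theorem Ccoeff_zero_right (m a b : ℕ) : Ccoeff (m + 1) a b 0 = wcoeff (m + 1) a b := by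
  have hdvd : (X 5 : MvPolynomial (Fin 6) ℚ) ∣
      P2k (m + 1) - rename (Fin.castAdd 2) (w2k (m + 1)) * monomial (Finsupp.single 4 (2 * m)) 1 := by
    rw [← X_pow_eq_monomial, pow_mul]
    simp only [P2k, w2k, Nat.add_sub_cancel, map_pow, ← mul_pow]
    refine Dvd.dvd.trans ?_ (sub_dvd_pow_sub_pow _ _ m)
    simp only [map_mul, map_sub, map_neg, rename_X]
    rw [show Fin.castAdd 2 (0 : Fin 4) = (0 : Fin 6) from rfl,
      show Fin.castAdd 2 (1 : Fin 4) = (1 : Fin 6) from rfl,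
      show Fin.castAdd 2 (2 : Fin 4) = (2 : Fin 6) from rfl,
      show Fin.castAdd 2 (3 : Fin 4) = (3 : Fin 6) from rfl]
    exact ⟨(X 0 * X 3 - X 2 * X 1) * (X 2 * (X 4 * X 1 - X 0 * X 5) + X 4 * X 3 * X 0), by ring⟩
  have hexp : (Finsupp.equivFunOnFinite.symm
        ![2 * (m + 1) - 2 - a, a, 2 * (m + 1) - 2 - b, b, 2 * (m + 1) - 2 - 0, 0] : Fin 6 →₀ ℕ)
      = (Finsupp.equivFunOnFinite.symm
          ![2 * (m + 1) - 2 - a, a, 2 * (m + 1) - 2 - b, b]).mapDomain (Fin.castAdd 2)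
        + Finsupp.single 4 (2 * m) := by
    ext i
    refine Fin.addCases (m := 4) (n := 2) (fun j => ?_) (fun j => ?_) i
    · rw [Finsupp.add_apply, Finsupp.mapDomain_apply (Fin.castAdd_injective 4 2)]
      fin_cases j <;> simp [Fin.ext_iff]
    · rw [Finsupp.add_apply, Finsupp.mapDomain_of_notMem_range]
      · fin_cases j <;> simp [Fin.ext_iff, Fin.natAdd]
        omega
      · rintro ⟨x, hx⟩
        have := congrArg Fin.val hx
        simp at this
        omega
  obtain ⟨Q, hQ⟩ := hdvd
  rw [Ccoeff, sub_eq_iff_eq_add.mp hQ, coeff_add, coeff_X_mul', if_neg (by simp), zero_add, hexp,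
    coeff_mul_monomial, coeff_rename_mapDomain _ (Fin.castAdd_injective 4 2), mul_one, wcoeff]

theorem wcoeff_add_sub {m j : ℕ} (hj : j ≤ m) :
    wcoeff (m + 1) (m + j) (2 * m - j) = (-1) ^ (m + j) * (m.choose j : ℚ) := by
  have hw : w2k (m + 1) = ∑ i ∈ Finset.range (m + 1),
      monomial (Finsupp.equivFunOnFinite.symm ![m - i, m + i, i, m + (m - i)])
        ((-1) ^ (m + i) * (m.choose i : ℚ)) := by
    rw [w2k, Nat.add_sub_cancel, mul_pow, mul_pow, sub_eq_neg_add, add_pow, Finset.mul_sum]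
    refine Finset.sum_congr rfl fun i _ => ?_
    rw [monomial_eq, Finsupp.prod_fintype _ _ (by simp)]
    simp only [Fin.prod_univ_four, Finsupp.equivFunOnFinite_symm_apply_apply, map_mul, map_pow,
      map_neg, map_one, map_natCast, neg_pow (X 1 : MvPolynomial (Fin 4) ℚ),
      neg_pow (X 2 * X 1 : MvPolynomial (Fin 4) ℚ), mul_pow, pow_add]
    simp
    ring
  rw [wcoeff, hw, coeff_sum, Finset.sum_eq_single j]
  · rw [coeff_monomial, if_pos]
    congr 1
    ext i
    fin_cases i <;> simp <;> omega
  · intro i _ hij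
    rw [coeff_monomial, if_neg]
    intro h
    have := DFunLike.congr_fun h 1
    simp at this
    exact hij this
  · intro h
    exact absurd (Finset.mem_range.mpr (by omega)) h

theorem sum_inv_choose_mul_choose_sq (m : ℕ) :
    ∑ j ∈ Finset.range (m + 1), ((2 * m).choose (m + j) : ℚ)⁻¹ * ((2 * m).choose (2 * m - j) : ℚ)⁻¹ *
        (m.choose j : ℚ) ^ 2
      = (m.factorial : ℚ) ^ 3 * ((3 * m + 1).factorial : ℚ) /
          (((2 * m).factorial : ℚ) ^ 2 * ((2 * m + 1).factorial : ℚ)) := by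
  have hterm : ∀ j ∈ Finset.range (m + 1),
      ((2 * m).choose (m + j) : ℚ)⁻¹ * ((2 * m).choose (2 * m - j) : ℚ)⁻¹ * (m.choose j : ℚ) ^ 2
        = (m.factorial : ℚ) ^ 4 / ((2 * m).factorial : ℚ) ^ 2 *
          (((m + j).choose m * (m + (m - j)).choose m : ℕ) : ℚ) := by
    intro j hj
    obtain ⟨d, rfl⟩ := Nat.exists_eq_add_of_le (Finset.mem_range_succ_iff.mp hj)
    rw [show 2 * (j + d) - j = j + d + d by omega, show j + d - j = d by omega,
      Nat.cast_choose ℚ (show j + d + j ≤ 2 * (j + d) by omega),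
      Nat.cast_choose ℚ (show j + d + d ≤ 2 * (j + d) by omega), Nat.cast_mul,
      Nat.cast_add_choose, Nat.cast_add_choose, Nat.cast_add_choose,
      show 2 * (j + d) - (j + d + j) = d by omega, show 2 * (j + d) - (j + d + d) = j by omega]
    field_simp
  rw [Finset.sum_congr rfl hterm, ← Finset.mul_sum, ← Nat.cast_sum, sum_choose_add_mul_choose_add,
    Nat.cast_add_choose, show m + m + 1 = 2 * m + 1 by ring,
    show 2 * m + 1 + m = 3 * m + 1 by ring]
  field_simp

theorem pairing_w2k_P2k (k : ℕ) (hk : 1 ≤ k) (i : ℕ) (hi : i ≤ 2 * k - 2) :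
    ∑ a₁ ∈ Finset.range (2 * k - 1), ∑ a₂ ∈ Finset.range (2 * k - 1),
        ((2 * k - 2).choose a₁ : ℚ)⁻¹ * ((2 * k - 2).choose a₂ : ℚ)⁻¹ *
          ((2 * k - 2).choose i : ℚ)⁻¹ * wcoeff k a₁ a₂ * Ccoeff k a₁ a₂ i
      = if i = 0 then
          ((k - 1).factorial : ℚ) ^ 3 * ((3 * k - 2).factorial : ℚ) /
            (((2 * k - 2).factorial : ℚ) ^ 2 * ((2 * k - 1).factorial : ℚ))
        else 0 := by
  obtain ⟨m, rfl⟩ := Nat.exists_eq_add_of_le' hk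
  rw [show 2 * (m + 1) - 2 = 2 * m by omega, show 2 * (m + 1) - 1 = 2 * m + 1 by omega,
    show 3 * (m + 1) - 2 = 3 * m + 1 by omega, Nat.add_sub_cancel]
  split_ifs with h
  · subst h
    rw [← sum_inv_choose_mul_choose_sq, ← Finset.sum_product']
    symm
    refine Finset.sum_of_injOn (fun j => (m + j, 2 * m - j)) ?_ ?_ ?_ ?_
    · intro a _ b _ hab
      simpa using congrArg Prod.fst hab
    · intro j hj
      simp at hj ⊢
      omega
    · rintro ⟨a, b⟩ hab hnot
      simp only [Finset.mem_product, Finset.mem_range] at hab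
      rw [wcoeff_eq_zero_of_add_ne, mul_zero, zero_mul]
      intro hsum
      refine hnot ⟨a - m, ?_, ?_⟩
      · simp
        omega
      · simp
        omega
    · intro j hj
      rw [Ccoeff_zero_right, wcoeff_add_sub (Finset.mem_range_succ_iff.mp hj)]
      have hsign : ((-1 : ℚ) ^ (m + j)) ^ 2 = 1 := by rw [← pow_mul, mul_comm, pow_mul]; simp
      simp only [Nat.choose_zero_right, Nat.cast_one, inv_one, mul_one]
      linear_combination (-((2 * m).choose (m + j) : ℚ)⁻¹ * ((2 * m).choose (2 * m - j) : ℚ)⁻¹ *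
        (m.choose j : ℚ) ^ 2) * hsign
  · refine Finset.sum_eq_zero fun a _ => Finset.sum_eq_zero fun b _ => ?_
    by_cases hsum : a + b = 3 * m
    · rw [Ccoeff_eq_zero_of_add_ne (m := m) (by omega), mul_zero]
    · rw [wcoeff_eq_zero_of_add_ne hsum, mul_zero, zero_mul]
end

section
/- For every integer k ≥ 1, ∑_{i=0}^{2k−2} ∑_{j=0}^{2k−2} ∑_{r=0}^{2k−2} C(2k−2, i)⁻¹ · C(2k−2, j)⁻¹ · C(2k−2, r)⁻¹ · (C_{i,j,r})² = ((k−1)!)³ · (3k−2)! / ((2k−2)!)³ in the rational numbers. (This expresses that the squared norm ‖P_{2k}‖² of P_{2k}, for the invariant inner product in which the monomials X^{a}Y^{2k−2−a} are orthogonal with squared length C(2k−2, a)⁻¹ in each of the three pairs of variables, equals Γ(k)³Γ(3k−1)/Γ(2k−1)³.) -/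
open MvPolynomial

section Bracket

variable {σ R : Type*} [CommRing R]

/-- The bracket `X_a X_d - X_c X_b`, for pairs of variables `(a, b)` and `(c, d)`. -/
noncomputable def bracket (R : Type*) [CommRing R] (a b c d : σ) : MvPolynomial σ R :=
  X a * X d - X c * X b

/-- The product of powers of the three brackets formed by three pairs of variables. -/
noncomputable def bracketProd (R : Type*) [CommRing R] (v : Fin 6 → σ) (a b c : ℕ) :
    MvPolynomial σ R :=
  bracket R (v 0) (v 1) (v 2) (v 3) ^ a * bracket R (v 2) (v 3) (v 4) (v 5) ^ b *
    bracket R (v 4) (v 5) (v 0) (v 1) ^ c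

/-- Cayley's Omega operator lowers the exponent of a bracket. -/
theorem omega_bracketProd (v : Fin 6 → σ) (hv : Function.Injective v) (a b c : ℕ) :
    pderiv (v 3) (pderiv (v 0) (bracketProd R v (a + 1) b c)) -
        pderiv (v 1) (pderiv (v 2) (bracketProd R v (a + 1) b c)) =
      (((a + 1) * (a + b + c + 2) : ℕ) : R) • bracketProd R v a b c := by
  classical
  rw [Nat.cast_smul_eq_nsmul, nsmul_eq_mul]
  have hX (i j : Fin 6) : pderiv (v i) (X (v j) : MvPolynomial σ R) = if i = j then 1 else 0 := by
    rw [pderiv_X]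
    by_cases h : i = j
    · simp [h]
    · rw [Pi.single_eq_of_ne (fun e => h (hv e).symm), if_neg h]
  unfold bracketProd bracket
  rcases a with _ | a <;> rcases b with _ | b <;> rcases c with _ | c <;>
  · simp [hX, -pderiv_X]
    ring

theorem bracketProd_rotate (v : Fin 6 → σ) (a b c : ℕ) :
    bracketProd R v a b c = bracketProd R (fun i => v (i + 2)) b c a := by
  unfold bracketProd
  simp only [Fin.isValue, Fin.reduceAdd]
  ring

end Bracket

open Nat in
/-- The Fischer (apolar) bilinear form, for which distinct monomials are orthogonal and the monomial
`X ^ m` has squared norm `∏ i, (m i)!`. -/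
noncomputable def fischer {σ R : Type*} [Fintype σ] [CommRing R] :
    MvPolynomial σ R →ₗ[R] MvPolynomial σ R →ₗ[R] R :=
  (basisMonomials σ R).constr R fun m => ((∏ i, (m i)! : ℕ) : R) • lcoeff R m

section Fischer

variable {σ R : Type*} [Fintype σ] [CommRing R]

open Nat in
theorem fischer_monomial (m : σ →₀ ℕ) (a : R) (g : MvPolynomial σ R) :
    fischer (monomial m a) g = a * ((∏ i, (m i)! : ℕ) : R) * coeff m g := by
  have h : fischer (monomial m (1 : R)) = ((∏ i, (m i)! : ℕ) : R) • lcoeff R m := by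
    have := (basisMonomials σ R).constr_basis R
      (fun m => ((∏ i, (m i)! : ℕ) : R) • lcoeff R m) m
    rwa [coe_basisMonomials] at this
  rw [← mul_one a, ← smul_eq_mul a 1, ← smul_monomial, map_smul, h]
  simp [mul_assoc]

open Nat in
theorem fischer_eq_sum (f g : MvPolynomial σ R) :
    fischer f g = ∑ m ∈ f.support, coeff m f * ((∏ i, (m i)! : ℕ) : R) * coeff m g := by
  conv_lhs => rw [← support_sum_monomial_coeff f]
  simp only [map_sum, LinearMap.sum_apply, fischer_monomial]

theorem fischer_X_mul (i : σ) (f g : MvPolynomial σ R) :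
    fischer (X i * f) g = fischer f (pderiv i g) := by
  classical
  induction f using MvPolynomial.induction_on' with
  | monomial m a =>
    have hprod : ∏ j, ((m + Finsupp.single i 1 : σ →₀ ℕ) j).factorial =
        (m i + 1) * ∏ j, (m j).factorial := by
      rw [← Finset.mul_prod_erase _ _ (Finset.mem_univ i),
        ← Finset.mul_prod_erase _ (fun j => (m j).factorial) (Finset.mem_univ i), ← mul_assoc]
      congr 1
      · simp [Nat.factorial_succ]
      · refine Finset.prod_congr rfl fun j hj => ?_
        simp [Finsupp.single_eq_of_ne (Finset.ne_of_mem_erase hj)]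
    rw [mul_comm, ← pow_one (X i), ← monomial_add_single, fischer_monomial, fischer_monomial,
      coeff_pderiv, hprod]
    push_cast
    ring
  | add f f' hf hf' => simp [mul_add, hf, hf']

theorem fischer_bracket_mul (a b c d : σ) (f g : MvPolynomial σ R) :
    fischer (bracket R a b c d * f) g =
      fischer f (pderiv d (pderiv a g) - pderiv b (pderiv c g)) := by
  rw [bracket, sub_mul, mul_assoc, mul_assoc, map_sub, LinearMap.sub_apply, map_sub]
  simp only [fischer_X_mul]

theorem fischer_bracketProd_succ (v : Fin 6 → σ) (hv : Function.Injective v) (a b c : ℕ) :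
    fischer (bracketProd R v (a + 1) b c) (bracketProd R v (a + 1) b c) =
      (((a + 1) * (a + b + c + 2) : ℕ) : R) *
        fischer (bracketProd R v a b c) (bracketProd R v a b c) := by
  have h : bracketProd R v (a + 1) b c =
      bracket R (v 0) (v 1) (v 2) (v 3) * bracketProd R v a b c := by
    unfold bracketProd
    ring
  conv_lhs => enter [1, 2]; rw [h]
  rw [fischer_bracket_mul, omega_bracketProd v hv, map_smul, smul_eq_mul]

open Nat in
theorem fischer_bracketProd_self (v : Fin 6 → σ) (hv : Function.Injective v) (a b c : ℕ) :
    fischer (bracketProd R v a b c) (bracketProd R v a b c) =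
      ((a ! * b ! * c ! * (a + b + c + 1)! : ℕ) : R) := by
  have hv' : Function.Injective fun i => v (i + 2) := hv.comp (add_left_injective 2)
  have hv'' : Function.Injective fun i => v (i + 2 + 2) := hv'.comp (add_left_injective 2)
  induction a with
  | zero =>
    induction b with
    | zero =>
      induction c with
      | zero =>
        have h := fischer_monomial (0 : σ →₀ ℕ) (1 : R) 1
        simp only [bracketProd, pow_zero, mul_one]
        rw [show monomial (0 : σ →₀ ℕ) (1 : R) = 1 from C_1] at h
        simp [h]
      | succ c ih =>
        rw [bracketProd_rotate, bracketProd_rotate] at ih ⊢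
        rw [fischer_bracketProd_succ _ hv'', ih, ← Nat.cast_mul]
        congr 1
        simp only [Nat.factorial_succ, Nat.factorial_zero, zero_add, add_zero]
        ring
    | succ b ih =>
      rw [bracketProd_rotate] at ih ⊢
      rw [fischer_bracketProd_succ _ hv', ih, ← Nat.cast_mul]
      congr 1
      rw [show 0 + (b + 1) + c + 1 = (0 + b + c + 1) + 1 by ring, Nat.factorial_succ (0 + b + c + 1),
        Nat.factorial_succ b]
      ring
  | succ a ih =>
    rw [fischer_bracketProd_succ v hv, ih, ← Nat.cast_mul]
    congr 1
    rw [show a + 1 + b + c + 1 = (a + b + c + 1) + 1 by ring, Nat.factorial_succ (a + b + c + 1),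
      Nat.factorial_succ a]
    ring

end Fischer

/-- The multidegree on `MvPolynomial (Fin 6) ℚ` in the three pairs of variables. -/
def pairWeight : Fin 6 → ℕ × ℕ × ℕ :=
  ![(1, 0, 0), (1, 0, 0), (0, 1, 0), (0, 1, 0), (0, 0, 1), (0, 0, 1)]

theorem isWeightedHomogeneous_P2k (n : ℕ) :
    IsWeightedHomogeneous pairWeight (P2k (n + 1)) (2 * n, 2 * n, 2 * n) := by
  have hX := isWeightedHomogeneous_X ℚ pairWeight
  have h := ((((hX 0).mul (hX 3)).sub ((hX 2).mul (hX 1))).pow n).mul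
    ((((hX 2).mul (hX 5)).sub ((hX 4).mul (hX 3))).pow n) |>.mul
    ((((hX 4).mul (hX 1)).sub ((hX 0).mul (hX 5))).pow n)
  have hw : n • (pairWeight 0 + pairWeight 3) + n • (pairWeight 2 + pairWeight 5) +
      n • (pairWeight 4 + pairWeight 1) = (2 * n, 2 * n, 2 * n) := by
    simp [pairWeight, -nsmul_eq_mul]
    omega
  rw [hw] at h
  exact h

/-- The exponent of `X₁^{N-i} Y₁^i X₂^{N-j} Y₂^j X₃^{N-r} Y₃^r`. -/
noncomputable def tripleExponent (N : ℕ) (t : ℕ × ℕ × ℕ) : Fin 6 →₀ ℕ :=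
  Finsupp.equivFunOnFinite.symm
    ![N - t.1, t.1, N - t.2.1, t.2.1, N - t.2.2, t.2.2]

theorem tripleExponent_injective (N : ℕ) : Function.Injective (tripleExponent N) := by
  rintro ⟨i, j, r⟩ ⟨i', j', r'⟩ h
  have h1 := DFunLike.congr_fun h 1
  have h3 := DFunLike.congr_fun h 3
  have h5 := DFunLike.congr_fun h 5
  simp [tripleExponent] at h1 h3 h5
  simp [h1, h3, h5]

theorem support_P2k_subset (n : ℕ) :
    (P2k (n + 1)).support ⊆
      (Finset.range (2 * n + 1) ×ˢ Finset.range (2 * n + 1) ×ˢ Finset.range (2 * n + 1)).image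
        (tripleExponent (2 * n)) := by
  intro m hm
  have h := isWeightedHomogeneous_P2k n (mem_support_iff.mp hm)
  simp [Finsupp.weight_eq_sum, Fin.sum_univ_six, pairWeight, -nsmul_eq_mul] at h
  rw [Finset.mem_image]
  refine ⟨(m 1, m 3, m 5), by simp; omega, ?_⟩
  ext i
  fin_cases i <;> simp [tripleExponent] <;> omega

theorem inv_choose_eq {N i : ℕ} (hi : i ≤ N) :
    ((N.choose i : ℕ) : ℚ)⁻¹ = ((N - i).factorial * i.factorial : ℚ) / N.factorial := by
  rw [Nat.cast_choose ℚ hi, inv_div, mul_comm]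

theorem fischer_P2k_self (n : ℕ) :
    fischer (P2k (n + 1)) (P2k (n + 1)) =
      (n.factorial : ℚ) ^ 3 * ((3 * n + 1).factorial : ℚ) := by
  have h : P2k (n + 1) = bracketProd ℚ id n n n := rfl
  rw [h, fischer_bracketProd_self _ Function.injective_id,
    show n + n + n + 1 = 3 * n + 1 by ring]
  push_cast
  ring

theorem norm_sq_P2k (k : ℕ) (hk : 1 ≤ k) :
    ∑ i ∈ Finset.range (2 * k - 1), ∑ j ∈ Finset.range (2 * k - 1),
      ∑ r ∈ Finset.range (2 * k - 1),
        ((2 * k - 2).choose i : ℚ)⁻¹ * ((2 * k - 2).choose j : ℚ)⁻¹ *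
          ((2 * k - 2).choose r : ℚ)⁻¹ * (Ccoeff k i j r) ^ 2
      = ((k - 1).factorial : ℚ) ^ 3 * ((3 * k - 2).factorial : ℚ) /
          ((2 * k - 2).factorial : ℚ) ^ 3 := by
  obtain ⟨n, rfl⟩ : ∃ n, k = n + 1 := ⟨k - 1, by omega⟩
  have h1 : 2 * (n + 1) - 1 = 2 * n + 1 := by omega
  have h2 : 2 * (n + 1) - 2 = 2 * n := by omega
  have h3 : 3 * (n + 1) - 2 = 3 * n + 1 := by omega
  rw [h1, h2, h3, Nat.add_sub_cancel, ← fischer_P2k_self, fischer_eq_sum,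
    Finset.sum_subset (support_P2k_subset n)
      (fun m _ hm => by simp [notMem_support_iff.mp hm]),
    Finset.sum_image (tripleExponent_injective _).injOn, Finset.sum_product, Finset.sum_div]
  refine Finset.sum_congr rfl fun i hi => ?_
  rw [Finset.sum_product, Finset.sum_div]
  refine Finset.sum_congr rfl fun j hj => ?_
  rw [Finset.sum_div]
  refine Finset.sum_congr rfl fun r hr => ?_
  rw [inv_choose_eq (Finset.mem_range_succ_iff.mp hi),
    inv_choose_eq (Finset.mem_range_succ_iff.mp hj),
    inv_choose_eq (Finset.mem_range_succ_iff.mp hr)]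
  have hC : Ccoeff (n + 1) i j r = coeff (tripleExponent (2 * n) (i, j, r)) (P2k (n + 1)) := by
    rw [Ccoeff, h2, tripleExponent]
  rw [← hC]
  simp [tripleExponent, Fin.prod_univ_six]
  ring
end

section
/- Let F be a field of characteristic not 2, let a, b ∈ F be nonzero, and let D = (a, b / F) be the quaternion algebra over F with basis 1, i, j, k, where i² = a, j² = b, and ij = −ji = k. Assume that every nonzero element of D is invertible. Let x = β·i + γ·j + δ·k with (β, γ, δ) ≠ (0, 0, 0). Then for every nonzero g ∈ D: there exists a nonzero c ∈ F with g·x = c·(x·g) if and only if either there exist λ, μ ∈ F with g = λ·1 + μ·x, or there exist x₁, x₂, x₃ ∈ F with g = x₁·i + x₂·j + x₃·k and a·β·x₁ + b·γ·x₂ = a·b·δ·x₃. (That is, for trace-zero x the centralizer of the image of x in F^×\D^× consists of the images of {λ + μx} ∩ D^× together with the pure quaternions orthogonal to x.) -/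
open Quaternion

namespace QuaternionAlgebra

variable {R : Type*} [CommRing R] {a b : R}

theorem mk_zero_mul_self (β γ δ : R) :
    (⟨0, β, γ, δ⟩ : ℍ[R, a, b]) * ⟨0, β, γ, δ⟩ =
      ((a * β ^ 2 + b * γ ^ 2 - a * b * δ ^ 2 : R) : ℍ[R, a, b]) := by
  rw [mk_mul_mk, coe]
  ext <;> ring

theorem norm_form_ne_zero_of_isUnit [Nontrivial R] {β γ δ : R}
    (h : IsUnit (⟨0, β, γ, δ⟩ : ℍ[R, a, b])) :
    a * β ^ 2 + b * γ ^ 2 - a * b * δ ^ 2 ≠ 0 := by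
  intro hq
  have hu := h.mul h
  rw [mk_zero_mul_self, hq, coe_zero] at hu
  exact not_isUnit_zero hu

theorem mul_eq_smul_mul_iff {t x₁ x₂ x₃ β γ δ c : R} :
    (⟨t, x₁, x₂, x₃⟩ : ℍ[R, a, b]) * ⟨0, β, γ, δ⟩ =
        c • ((⟨0, β, γ, δ⟩ : ℍ[R, a, b]) * ⟨t, x₁, x₂, x₃⟩) ↔
      (1 - c) * (a * β * x₁ + b * γ * x₂ - a * b * δ * x₃) = 0 ∧
      (1 - c) * (t * β) + (1 + c) * (b * (x₃ * γ - x₂ * δ)) = 0 ∧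
      (1 - c) * (t * γ) + (1 + c) * (a * (x₁ * δ - x₃ * β)) = 0 ∧
      (1 - c) * (t * δ) + (1 + c) * (x₁ * γ - x₂ * β) = 0 := by
  simp only [mk_mul_mk, smul_mk, mk.injEq, smul_eq_mul]
  refine and_congr ?_ (and_congr ?_ (and_congr ?_ ?_)) <;>
    constructor <;> intro h <;> linear_combination h

end QuaternionAlgebra

theorem centralizer_trace_zero (F : Type*) [Field F] (hchar : (2 : F) ≠ 0)
    (a b : F) (ha : a ≠ 0) (hb : b ≠ 0)
    (hdiv : ∀ x : ℍ[F, a, b], x ≠ 0 → IsUnit x)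
    (β γ δ : F) (him : (β, γ, δ) ≠ (0, 0, 0)) :
    ∀ g : ℍ[F, a, b], g ≠ 0 →
      ((∃ c : F, c ≠ 0 ∧
          g * (⟨0, β, γ, δ⟩ : ℍ[F, a, b]) = c • ((⟨0, β, γ, δ⟩ : ℍ[F, a, b]) * g)) ↔
        ((∃ l m : F, g = l • (1 : ℍ[F, a, b]) + m • (⟨0, β, γ, δ⟩ : ℍ[F, a, b])) ∨
          (∃ x₁ x₂ x₃ : F, g = (⟨0, x₁, x₂, x₃⟩ : ℍ[F, a, b]) ∧
            a * β * x₁ + b * γ * x₂ = a * b * δ * x₃))) := by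
  rintro ⟨t, x₁, x₂, x₃⟩ -
  have hx : (⟨0, β, γ, δ⟩ : ℍ[F, a, b]) ≠ 0 := by
    intro h
    obtain ⟨-, rfl, rfl, rfl⟩ := QuaternionAlgebra.ext_iff.mp h
    exact him rfl
  have hq := QuaternionAlgebra.norm_form_ne_zero_of_isUnit (hdiv _ hx)
  constructor
  · rintro ⟨c, -, h⟩
    obtain ⟨h0, h1, h2, h3⟩ := QuaternionAlgebra.mul_eq_smul_mul_iff.mp h
    by_cases hc : c = 1
    · subst hc
      have w1 : x₃ * γ - x₂ * δ = 0 :=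
        mul_left_cancel₀ (mul_ne_zero hchar hb) (by linear_combination h1)
      have w2 : x₁ * δ - x₃ * β = 0 :=
        mul_left_cancel₀ (mul_ne_zero hchar ha) (by linear_combination h2)
      have w3 : x₁ * γ - x₂ * β = 0 :=
        mul_left_cancel₀ hchar (by linear_combination h3)
      refine .inl ⟨t, (a * β * x₁ + b * γ * x₂ - a * b * δ * x₃) /
        (a * β ^ 2 + b * γ ^ 2 - a * b * δ ^ 2), ?_⟩
      ext
      · simp
      · simp only [QuaternionAlgebra.imI_add, QuaternionAlgebra.imI_smul,
          QuaternionAlgebra.imI_one, smul_eq_mul, mul_zero, zero_add, div_mul_eq_mul_div]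
        rw [eq_div_iff hq]
        linear_combination b * γ * w3 - a * b * δ * w2
      · simp only [QuaternionAlgebra.imJ_add, QuaternionAlgebra.imJ_smul,
          QuaternionAlgebra.imJ_one, smul_eq_mul, mul_zero, zero_add, div_mul_eq_mul_div]
        rw [eq_div_iff hq]
        linear_combination -a * β * w3 + a * b * δ * w1
      · simp only [QuaternionAlgebra.imK_add, QuaternionAlgebra.imK_smul,
          QuaternionAlgebra.imK_one, smul_eq_mul, mul_zero, zero_add, div_mul_eq_mul_div]
        rw [eq_div_iff hq]
        linear_combination -a * β * w2 + b * γ * w1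
    · have hc' : 1 - c ≠ 0 := sub_ne_zero.mpr (Ne.symm hc)
      have ht : t = 0 := mul_left_cancel₀ (mul_ne_zero hc' hq)
        (by linear_combination a * β * h1 + b * γ * h2 - a * b * δ * h3)
      have hs := (mul_eq_zero.mp h0).resolve_left hc'
      exact .inr ⟨x₁, x₂, x₃, by rw [ht], sub_eq_zero.mp hs⟩
  · rintro (⟨l, m, hg⟩ | ⟨y₁, y₂, y₃, hg, hs⟩)
    · refine ⟨1, one_ne_zero, ?_⟩
      rw [hg, one_smul, add_mul, mul_add, smul_mul_assoc, smul_mul_assoc,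
        mul_smul_comm, mul_smul_comm, one_mul, mul_one]
    · refine ⟨-1, neg_ne_zero.mpr one_ne_zero, ?_⟩
      rw [hg, QuaternionAlgebra.mul_eq_smul_mul_iff]
      refine ⟨?_, by ring, by ring, by ring⟩
      linear_combination 2 * hs
end
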